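/- For every integer n ≥ 1 and all x, y ∈ Z_{n!}, one has x ≤! y for the order ≤! on ℚ ∩ (−1,0] if and only if x ≤! y for the recursive order on Z_{n!}. Hence the linearly ordered set (ℚ ∩ (−1,0], ≤!) is the increasing union of the linearly ordered sets (Z_{n!}, ≤!), n ≥ 1. -/

import Mathlib

/-- The recursive order `≤!` on `Z_{n!}`, expressed on indices: `recLE n k l` means
`-k/n! ≤! -l/n!`. -/
def recLE : ℕ → ℕ → ℕ → Prop
  | 0, _, _ => True
  | 1, _, _ => True
  | (n + 2), k, l =>
      l % (n + 2) < k % (n + 2) ∨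
      (k % (n + 2) = l % (n + 2) ∧ recLE (n + 1) (k / (n + 2)) (l / (n + 2)))

/-- Every rational is cleared to an integer by some factorial `n!` with `n ≥ 1`. -/
lemma exists_factorial_clear (x : ℚ) :
    ∃ n : ℕ, 1 ≤ n ∧ ∃ z : ℤ, ((n.factorial : ℚ) * x) = (z : ℚ) := by
  obtain ⟨c, hc⟩ := Nat.dvd_factorial x.den_pos (le_refl x.den)
  refine ⟨x.den, x.den_pos, ⟨c * x.num, ?_⟩⟩
  have hden : (x.den : ℚ) ≠ 0 := by exact_mod_cast x.den_pos.ne'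
  have hx : (x.den : ℚ) * x = (x.num : ℚ) := by
    rw [mul_comm, Rat.mul_den_eq_num]
  rw [hc]
  push_cast
  rw [mul_comm (x.den : ℚ) (c : ℚ), mul_assoc, hx]

/-- `nIdx x` is the least `n ≥ 1` such that `n! · x` is an integer
(the denominator of the normal factorial form of `x`). -/
noncomputable def nIdx (x : ℚ) : ℕ :=
  @Nat.find (fun n => 1 ≤ n ∧ ∃ z : ℤ, ((n.factorial : ℚ) * x) = (z : ℚ))
    (Classical.decPred _) (exists_factorial_clear x)

/-- `pIdx x` is the numerator `p` of the normal factorial form `x = -p/(nIdx x)!`. -/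
noncomputable def pIdx (x : ℚ) : ℕ :=
  (-(((nIdx x).factorial : ℚ) * x)).num.toNat

/-- The order `≤!` on `ℚ ∩ (-1, 0]`, via normal factorial forms. -/
noncomputable def qLE (x y : ℚ) : Prop :=
  nIdx y < nIdx x ∨ (nIdx x = nIdx y ∧ recLE (nIdx x) (pIdx x) (pIdx y))


/-- `Zset m` is the set `{ -k/m : k = 0, 1, …, m-1 } ⊆ ℚ ∩ (-1, 0]`. -/
def Zset (m : ℕ) : Set ℚ := {x | ∃ k : ℕ, k < m ∧ x = -(k : ℚ) / (m : ℚ)}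

lemma recLE_refl : ∀ n k : ℕ, recLE n k k
  | 0, _ => trivial
  | 1, _ => trivial
  | n + 2, k => Or.inr ⟨rfl, recLE_refl (n + 1) (k / (n + 2))⟩

lemma qLE_refl (x : ℚ) : qLE x x :=
  Or.inr ⟨rfl, recLE_refl _ _⟩

lemma nIdx_le {x : ℚ} {n : ℕ} (hn : 1 ≤ n) (h : ∃ z : ℤ, (n.factorial : ℚ) * x = z) :
    nIdx x ≤ n :=
  @Nat.find_min' _ (Classical.decPred _) (exists_factorial_clear x) n ⟨hn, h⟩

lemma nIdx_spec (x : ℚ) : 1 ≤ nIdx x ∧ ∃ z : ℤ, ((nIdx x).factorial : ℚ) * x = z :=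
  @Nat.find_spec _ (Classical.decPred _) (exists_factorial_clear x)

lemma factorial_mul_neg_div (n k : ℕ) :
    (n.factorial : ℚ) * (-(k : ℚ) / (n.factorial : ℚ)) = -(k : ℚ) :=
  mul_div_cancel₀ _ (by exact_mod_cast n.factorial_ne_zero)

lemma nIdx_neg_div_le {n : ℕ} (hn : 1 ≤ n) (k : ℕ) :
    nIdx (-(k : ℚ) / (n.factorial : ℚ)) ≤ n :=
  nIdx_le hn ⟨-(k : ℤ), by rw [factorial_mul_neg_div]; push_cast; rfl⟩

/-- Multiplying numerator and denominator by `n + 1` passes from `n!` to `(n + 1)!`. -/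
lemma neg_div_factorial_succ (n k : ℕ) :
    -(((n + 1) * k : ℕ) : ℚ) / ((n + 1).factorial : ℚ) = -(k : ℚ) / (n.factorial : ℚ) := by
  have h : (n.factorial : ℚ) ≠ 0 := by exact_mod_cast n.factorial_ne_zero
  have h' : (n : ℚ) + 1 ≠ 0 := by positivity
  rw [Nat.factorial_succ]
  push_cast
  field_simp

lemma nIdx_neg_div_eq {n k : ℕ} (hk : ¬ (n + 1) ∣ k) :
    nIdx (-(k : ℚ) / ((n + 1).factorial : ℚ)) = n + 1 := by
  refine le_antisymm (nIdx_neg_div_le (by omega) k) ?_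
  by_contra! hlt
  obtain ⟨-, z, hz⟩ := nIdx_spec (-(k : ℚ) / ((n + 1).factorial : ℚ))
  obtain ⟨c, hc⟩ := Nat.factorial_dvd_factorial (Nat.le_of_lt_succ hlt)
  have h := factorial_mul_neg_div (n + 1) k
  generalize -(k : ℚ) / ((n + 1).factorial : ℚ) = x at *
  have hkz : (k : ℤ) = ((n + 1 : ℕ) : ℤ) * (-(c * z)) := by
    have : (k : ℚ) = ((n : ℚ) + 1) * (-(c * z)) := by
      rw [Nat.factorial_succ, hc] at h
      push_cast at h
      rw [← hz]
      linear_combination h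
    exact_mod_cast this
  exact hk (Int.natCast_dvd_natCast.mp ⟨_, hkz⟩)

lemma pIdx_neg_div_eq {n k : ℕ} (hk : ¬ (n + 1) ∣ k) :
    pIdx (-(k : ℚ) / ((n + 1).factorial : ℚ)) = k := by
  rw [pIdx, nIdx_neg_div_eq hk, factorial_mul_neg_div, neg_neg]
  simp

lemma qLE_iff_recLE : ∀ n k l : ℕ, k < (n + 1).factorial → l < (n + 1).factorial →
    (qLE (-(k : ℚ) / ((n + 1).factorial : ℚ)) (-(l : ℚ) / ((n + 1).factorial : ℚ)) ↔
      recLE (n + 1) k l) := by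
  intro n
  induction n with
  | zero =>
    intro k l hk hl
    obtain rfl : k = 0 := by simpa using hk
    obtain rfl : l = 0 := by simpa using hl
    exact iff_of_true (qLE_refl _) trivial
  | succ n ih =>
    intro k l hk hl
    by_cases hkd : n + 1 + 1 ∣ k <;> by_cases hld : n + 1 + 1 ∣ l
    · obtain ⟨a, rfl⟩ := hkd
      obtain ⟨b, rfl⟩ := hld
      rw [Nat.factorial_succ] at hk hl
      rw [neg_div_factorial_succ, neg_div_factorial_succ,
        ih a b (Nat.lt_of_mul_lt_mul_left hk) (Nat.lt_of_mul_lt_mul_left hl)]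
      simp [recLE]
    · obtain ⟨a, rfl⟩ := hkd
      have hpos : 0 < l % (n + 2) := Nat.pos_of_ne_zero fun h => hld (Nat.dvd_of_mod_eq_zero h)
      have hle := nIdx_neg_div_le (n := n + 1) (by omega) a
      refine iff_of_false ?_ ?_
      · rw [qLE, nIdx_neg_div_eq hld, neg_div_factorial_succ]
        omega
      · simp only [recLE, Nat.mul_mod_right]
        omega
    · obtain ⟨b, rfl⟩ := hld
      have hpos : 0 < k % (n + 2) := Nat.pos_of_ne_zero fun h => hkd (Nat.dvd_of_mod_eq_zero h)
      have hle := nIdx_neg_div_le (n := n + 1) (by omega) b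
      refine iff_of_true (Or.inl ?_) (Or.inl ?_)
      · rw [nIdx_neg_div_eq hkd, neg_div_factorial_succ]
        omega
      · simpa using hpos
    · simp [qLE, nIdx_neg_div_eq hkd, nIdx_neg_div_eq hld, pIdx_neg_div_eq hkd,
        pIdx_neg_div_eq hld]

lemma Zset_factorial_subset_succ (n : ℕ) : Zset n.factorial ⊆ Zset (n + 1).factorial := by
  rintro x ⟨k, hk, rfl⟩
  refine ⟨(n + 1) * k, ?_, (neg_div_factorial_succ n k).symm⟩
  rw [Nat.factorial_succ]
  exact Nat.mul_lt_mul_of_pos_left hk n.succ_pos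

lemma Zset_factorial_subset_Ioc (n : ℕ) : Zset n.factorial ⊆ {x : ℚ | -1 < x ∧ x ≤ 0} := by
  rintro x ⟨k, hk, rfl⟩
  have hpos : (0 : ℚ) < n.factorial := by exact_mod_cast n.factorial_pos
  have hk' : (k : ℚ) < n.factorial := by exact_mod_cast hk
  refine ⟨?_, div_nonpos_of_nonpos_of_nonneg (by simp) hpos.le⟩
  rw [lt_div_iff₀ hpos]
  linarith

lemma exists_mem_Zset_factorial {x : ℚ} (hx : -1 < x) (hx0 : x ≤ 0) :
    ∃ n, 1 ≤ n ∧ x ∈ Zset n.factorial := by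
  obtain ⟨n, hn, z, hz⟩ := exists_factorial_clear x
  have hpos : (0 : ℚ) < n.factorial := by exact_mod_cast n.factorial_pos
  have hz0 : z ≤ 0 := by
    have : (z : ℚ) ≤ 0 := hz ▸ mul_nonpos_of_nonneg_of_nonpos hpos.le hx0
    exact_mod_cast this
  obtain ⟨k, rfl⟩ : ∃ k : ℕ, z = -(k : ℤ) := ⟨z.natAbs, by omega⟩
  push_cast at hz
  refine ⟨n, hn, k, ?_, ?_⟩
  · have : (k : ℚ) < n.factorial := by nlinarith
    exact_mod_cast this
  · rw [eq_div_iff hpos.ne', mul_comm, hz]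

theorem stmt6 :
    -- on Z_{n!} the global order ≤! coincides with the recursive order ≤!
    (∀ n : ℕ, 1 ≤ n → ∀ k l : ℕ, k < n.factorial → l < n.factorial →
      (qLE (-(k : ℚ) / (n.factorial : ℚ)) (-(l : ℚ) / (n.factorial : ℚ)) ↔ recLE n k l)) ∧
    -- the sets Z_{n!} form an increasing chain
    (∀ n : ℕ, 1 ≤ n → Zset n.factorial ⊆ Zset (n + 1).factorial) ∧
    -- whose union is all of ℚ ∩ (-1, 0]
    ({x : ℚ | -1 < x ∧ x ≤ 0} = ⋃ n ∈ {n : ℕ | 1 ≤ n}, Zset n.factorial) := by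
  refine ⟨fun n hn k l hk hl => ?_, fun n _ => Zset_factorial_subset_succ n, ?_⟩
  · obtain ⟨n, rfl⟩ := Nat.exists_eq_add_of_le' hn
    exact qLE_iff_recLE n k l hk hl
  · ext x
    simp only [Set.mem_iUnion, Set.mem_ofPred_eq, exists_prop]
    exact ⟨fun h => exists_mem_Zset_factorial h.1 h.2,
      fun ⟨n, _, h⟩ => Zset_factorial_subset_Ioc n h⟩
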